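/- For every n ≥ 1 and every t₀ > 0, the function t ↦ R_n(t) has a derivative at t₀ satisfying the Riccati equation 2 t₀ R_n'(t₀) = R_n(t₀)² + (1 − 2 r_n(t₀)) R_n(t₀) − 4(−1)^n t₀. -/

import Mathlib

open MeasureTheory Polynomial

/-- The singularly perturbed Gaussian weight `w(x,t) = exp(-x^2 - t/x^2)` for `x ≠ 0`,
extended by `0` at `x = 0`. -/
noncomputable def w (t x : ℝ) : ℝ := if x = 0 then 0 else Real.exp (-x ^ 2 - t / x ^ 2)

lemma w_zero (t : ℝ) : w t 0 = 0 := if_pos rfl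

lemma w_neg (t x : ℝ) : w t (-x) = w t x := by simp [w]

lemma measurable_w (t : ℝ) : Measurable (w t) :=
  Measurable.ite (measurableSet_singleton 0) measurable_const (by fun_prop)

lemma w_nonneg (t x : ℝ) : 0 ≤ w t x := by
  unfold w; split_ifs <;> positivity

/-- The singular factor `exp (-t / y ^ 2)` absorbs any negative power of `y`, uniformly for
`t` bounded away from zero. -/
lemma norm_pow_div_mul_w_le {ε t : ℝ} (hε : 0 < ε) (ht : ε ≤ t) (i j : ℕ) (y : ℝ) :
    ‖y ^ i / y ^ j * w t y‖ ≤ (j.factorial / ε ^ j) * (|y| ^ (i + j) * Real.exp (-y ^ 2)) := by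
  rcases eq_or_ne y 0 with rfl | hy
  · rw [w_zero, mul_zero, norm_zero]; positivity
  have hy2 : 0 < y ^ 2 := by positivity
  have habs : 0 < |y| := abs_pos.mpr hy
  have h1 : (ε / y ^ 2) ^ j / j.factorial ≤ Real.exp (ε / y ^ 2) :=
    Real.pow_div_factorial_le_exp _ (by positivity) j
  have h2 : Real.exp (-(t / y ^ 2)) ≤ j.factorial * (y ^ 2) ^ j / ε ^ j := by
    calc Real.exp (-(t / y ^ 2)) ≤ Real.exp (-(ε / y ^ 2)) := by gcongr
      _ = (Real.exp (ε / y ^ 2))⁻¹ := Real.exp_neg _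
      _ ≤ ((ε / y ^ 2) ^ j / j.factorial)⁻¹ := by gcongr
      _ = _ := by rw [div_pow]; field_simp
  rw [norm_mul, norm_div, norm_pow, norm_pow, Real.norm_eq_abs, Real.norm_eq_abs,
    abs_of_nonneg (w_nonneg t y), w, if_neg hy, sub_eq_add_neg, Real.exp_add]
  calc |y| ^ i / |y| ^ j * (Real.exp (-y ^ 2) * Real.exp (-(t / y ^ 2)))
      ≤ |y| ^ i / |y| ^ j * (Real.exp (-y ^ 2) * (j.factorial * (y ^ 2) ^ j / ε ^ j)) := by gcongr
    _ = _ := by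
      rw [← sq_abs y]
      field_simp
      ring

lemma integrable_abs_pow_mul_exp_neg_sq (n : ℕ) :
    Integrable fun y : ℝ => |y| ^ n * Real.exp (-y ^ 2) := by
  have h := (integrable_rpow_mul_exp_neg_mul_sq (b := 1) one_pos (s := n)
    (by have : (0 : ℝ) ≤ n := n.cast_nonneg
        linarith)).norm
  refine h.congr (.of_forall fun y => ?_)
  simp

lemma integrable_pow_div_mul_w {t : ℝ} (ht : 0 < t) (i j : ℕ) :
    Integrable fun y : ℝ => y ^ i / y ^ j * w t y := by
  refine ((integrable_abs_pow_mul_exp_neg_sq (i + j)).const_mul _).mono' ?_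
    (.of_forall fun y => norm_pow_div_mul_w_le ht le_rfl i j y)
  have := measurable_w t
  exact Measurable.aestronglyMeasurable (by fun_prop)

lemma integrable_eval_div_mul_w {t : ℝ} (ht : 0 < t) (j : ℕ) (p : ℝ[X]) :
    Integrable fun y : ℝ => p.eval y / y ^ j * w t y := by
  induction p using Polynomial.induction_on' with
  | add p q hp hq =>
    refine (hp.add hq).congr (.of_forall fun y => ?_)
    simp only [Pi.add_apply, eval_add]
    ring
  | monomial i a =>
    refine ((integrable_pow_div_mul_w ht i j).const_mul a).congr (.of_forall fun y => ?_)
    simp only [eval_monomial]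
    ring

/-- The linear functional `p ↦ ∫ p(y) y⁻ʲ w(y,t) dy` on polynomials. -/
noncomputable def wInt (t : ℝ) (j : ℕ) (p : ℝ[X]) : ℝ := ∫ y : ℝ, p.eval y / y ^ j * w t y

lemma hasDerivAt_wInt_X_pow {t : ℝ} (ht : 0 < t) (i j : ℕ) :
    HasDerivAt (fun s => wInt s j (X ^ i)) (-wInt t (j + 2) (X ^ i)) t := by
  simp only [wInt, eval_pow, eval_X]
  rw [← integral_neg]
  have hε : 0 < t / 2 := by positivity
  refine (hasDerivAt_integral_of_dominated_loc_of_deriv_le (𝕜 := ℝ)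
    (F := fun s (y : ℝ) => y ^ i / y ^ j * w s y)
    (F' := fun s (y : ℝ) => -(y ^ i / y ^ (j + 2) * w s y))
    (Ioi_mem_nhds (half_lt_self ht)) ?_ (integrable_pow_div_mul_w ht i j) ?_
    (.of_forall fun y s hs => ?_)
    ((integrable_abs_pow_mul_exp_neg_sq (i + (j + 2))).const_mul
      ((j + 2).factorial / (t / 2) ^ (j + 2))) (.of_forall fun y s hs => ?_)).2
  · refine .of_forall fun s => ?_
    have := measurable_w s
    exact Measurable.aestronglyMeasurable (by fun_prop)
  · exact (integrable_pow_div_mul_w ht i (j + 2)).neg.aestronglyMeasurable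
  · rw [norm_neg]
    exact norm_pow_div_mul_w_le hε (le_of_lt hs) i (j + 2) y
  · rcases eq_or_ne y 0 with rfl | hy
    · simpa [w_zero] using hasDerivAt_const s (0 : ℝ)
    · simp only [w, if_neg hy]
      have h1 : HasDerivAt (fun s : ℝ => -y ^ 2 - s / y ^ 2) (-(1 / y ^ 2)) s :=
        ((hasDerivAt_id s).div_const (y ^ 2)).const_sub _
      refine (h1.exp.const_mul (y ^ i / y ^ j)).congr_deriv ?_
      rw [pow_add]
      field_simp

lemma hasDerivAt_w_div (t : ℝ) (ht : 0 < t) (j : ℕ) (y : ℝ) :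
    HasDerivAt (fun y => w t y / y ^ j)
      (2 * t * (w t y / y ^ (j + 3)) - 2 * y * (w t y / y ^ j) - j * (w t y / y ^ (j + 1))) y := by
  rcases eq_or_ne y 0 with rfl | hy
  · have h : HasFDerivAt (fun y => w t y / y ^ j) (0 : ℝ →L[ℝ] ℝ) 0 := by
      refine Asymptotics.IsBigO.hasFDerivAt (n := j + 4)
        (.of_bound ((j + 2).factorial / t ^ (j + 2)) (.of_forall fun y => ?_)) (by omega)
      have h1 := norm_pow_div_mul_w_le ht le_rfl 2 (j + 2) y
      have h2 : y ^ 2 / y ^ (j + 2) * w t y = w t y / y ^ j := by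
        rcases eq_or_ne y 0 with rfl | hy
        · simp [w_zero]
        · field_simp
          ring
      rw [h2] at h1
      refine h1.trans ?_
      rw [sub_zero, norm_pow, norm_norm, Real.norm_eq_abs, show 2 + (j + 2) = j + 4 by ring]
      gcongr
      exact mul_le_of_le_one_right (by positivity) (Real.exp_le_one_iff.mpr (by nlinarith))
    simpa [w_zero] using h.hasDerivAt
  · have h1 : HasDerivAt (fun y : ℝ => -y ^ 2 - t / y ^ 2) (-(2 * y) + 2 * t / y ^ 3) y := by
      have h := ((hasDerivAt_pow 2 y).neg).sub
        ((hasDerivAt_const y t).div (hasDerivAt_pow 2 y) (by positivity))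
      refine h.congr_deriv ?_
      field_simp
      simp
      ring
    have h2 := (h1.exp.div (hasDerivAt_pow j y) (by positivity))
    have h3 : (fun y => w t y / y ^ j) =ᶠ[nhds y]
        fun y => Real.exp (-y ^ 2 - t / y ^ 2) / y ^ j := by
      filter_upwards [isOpen_ne.mem_nhds hy] with z hz
      simp only [w, if_neg (show z ≠ 0 from hz)]
    refine (h2.congr_of_eventuallyEq h3).congr_deriv ?_
    simp only [w, if_neg hy]
    rcases j with _ | j
    · simp
      field_simp
      ring
    · simp only [Nat.add_sub_cancel]
      field_simp
      ring

section functional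

variable {t : ℝ} (j : ℕ)

lemma wInt_add (ht : 0 < t) (p q : ℝ[X]) : wInt t j (p + q) = wInt t j p + wInt t j q := by
  rw [wInt, wInt, wInt,
    ← integral_add (integrable_eval_div_mul_w ht j p) (integrable_eval_div_mul_w ht j q)]
  congr 1; ext y
  rw [eval_add]; ring

lemma wInt_C_mul (a : ℝ) (p : ℝ[X]) : wInt t j (C a * p) = a * wInt t j p := by
  rw [wInt, wInt, ← integral_const_mul]
  congr 1; ext y
  rw [eval_mul, eval_C]; ring

lemma wInt_zero : wInt t j 0 = 0 := by simp [wInt]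

lemma wInt_sub (ht : 0 < t) (p q : ℝ[X]) : wInt t j (p - q) = wInt t j p - wInt t j q := by
  rw [sub_eq_add_neg, wInt_add j ht, ← neg_one_mul q, ← C_1, ← C_neg, wInt_C_mul]
  ring

lemma wInt_X_mul (p : ℝ[X]) : wInt t (j + 1) (X * p) = wInt t j p := by
  rw [wInt, wInt]
  congr 1; ext y
  rcases eq_or_ne y 0 with rfl | hy
  · simp [w_zero]
  · rw [eval_mul, eval_X]
    field_simp
    ring

lemma wInt_zero_comp_neg_X (p : ℝ[X]) : wInt t 0 (p.comp (-X)) = wInt t 0 p := by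
  rw [wInt, wInt, ← integral_neg_eq_self]
  congr 1; ext y
  simp [w_neg]

lemma wInt_parts (ht : 0 < t) (p : ℝ[X]) :
    wInt t j (derivative p) - j * wInt t (j + 1) p =
      2 * wInt t j (X * p) - 2 * t * wInt t (j + 3) p := by
  have hi := fun k q => integrable_eval_div_mul_w ht k q
  have hd : ∀ y, HasDerivAt (fun y => p.eval y / y ^ j * w t y)
      ((derivative p).eval y / y ^ j * w t y + (2 * t * (p.eval y / y ^ (j + 3) * w t y)
        - 2 * ((X * p).eval y / y ^ j * w t y) - j * (p.eval y / y ^ (j + 1) * w t y))) y := by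
    intro y
    have h := ((p.hasDerivAt y).mul (hasDerivAt_w_div t ht j y)).congr_of_eventuallyEq
      (f₁ := fun y => p.eval y / y ^ j * w t y)
      (.of_forall fun z => by simp only [Pi.mul_apply]; ring)
    refine h.congr_deriv ?_
    rw [eval_mul, eval_X]; ring
  have i1 : Integrable fun y => 2 * t * (p.eval y / y ^ (j + 3) * w t y)
      - 2 * ((X * p).eval y / y ^ j * w t y) :=
    ((hi (j + 3) p).const_mul (2 * t)).sub ((hi j (X * p)).const_mul 2)
  have i2 : Integrable fun y => 2 * t * (p.eval y / y ^ (j + 3) * w t y)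
      - 2 * ((X * p).eval y / y ^ j * w t y) - j * (p.eval y / y ^ (j + 1) * w t y) :=
    i1.sub ((hi (j + 1) p).const_mul (j : ℝ))
  have h3 := integral_eq_zero_of_hasDerivAt_of_integrable hd
    ((hi j (derivative p)).add i2) (hi j p)
  rw [integral_add (hi j (derivative p)) i2, integral_sub i1 ((hi (j + 1) p).const_mul (j : ℝ)),
    integral_sub ((hi (j + 3) p).const_mul (2 * t)) ((hi j (X * p)).const_mul 2),
    integral_const_mul, integral_const_mul, integral_const_mul] at h3
  simp only [wInt]
  linarith

end functional

lemma wInt_eq_sum {t : ℝ} (ht : 0 < t) (j : ℕ) {p : ℝ[X]} {N : ℕ} (hN : p.natDegree ≤ N) :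
    wInt t j p = ∑ i ∈ Finset.range (N + 1), p.coeff i * wInt t j (X ^ i) := by
  simp only [wInt, ← integral_const_mul]
  rw [← integral_finsetSum]
  · congr 1; ext y
    rw [eval_eq_sum_range' (Nat.lt_succ_of_le hN), Finset.sum_div, Finset.sum_mul]
    refine Finset.sum_congr rfl fun i _ => ?_
    rw [eval_pow, eval_X]; ring
  · exact fun i _ => (integrable_eval_div_mul_w ht j (X ^ i)).const_mul _

/-- `p` is a curve of polynomials of locally bounded degree whose coefficientwise derivative at `t`
is `q`. -/
def HasPolyDerivAt (p : ℝ → ℝ[X]) (q : ℝ[X]) (t : ℝ) : Prop :=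
  (∃ N, ∀ᶠ s in nhds t, (p s).natDegree ≤ N) ∧
    ∀ i, HasDerivAt (fun s => (p s).coeff i) (q.coeff i) t

namespace HasPolyDerivAt

variable {p p₁ p₂ : ℝ → ℝ[X]} {q q₁ q₂ : ℝ[X]} {t : ℝ}

lemma const (p : ℝ[X]) (t : ℝ) : HasPolyDerivAt (fun _ => p) 0 t :=
  ⟨⟨p.natDegree, .of_forall fun _ => le_rfl⟩, fun i => by
    simpa using hasDerivAt_const t (p.coeff i)⟩

lemma mul (h₁ : HasPolyDerivAt p₁ q₁ t) (h₂ : HasPolyDerivAt p₂ q₂ t) :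
    HasPolyDerivAt (fun s => p₁ s * p₂ s) (q₁ * p₂ t + p₁ t * q₂) t := by
  obtain ⟨⟨N₁, hN₁⟩, hd₁⟩ := h₁
  obtain ⟨⟨N₂, hN₂⟩, hd₂⟩ := h₂
  refine ⟨⟨N₁ + N₂, ?_⟩, fun i => ?_⟩
  · filter_upwards [hN₁, hN₂] with s hs₁ hs₂
    exact natDegree_mul_le.trans (add_le_add hs₁ hs₂)
  · simp only [coeff_mul, coeff_add, ← Finset.sum_add_distrib]
    exact HasDerivAt.fun_sum fun x _ => (hd₁ x.1).mul (hd₂ x.2)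

lemma natDegree_le {N : ℕ} (h : HasPolyDerivAt p q t)
    (hN : ∀ᶠ s in nhds t, (p s).natDegree ≤ N) : q.natDegree ≤ N := by
  refine natDegree_le_iff_coeff_eq_zero.mpr fun i hi => ?_
  refine (h.2 i).unique ((hasDerivAt_const t (0 : ℝ)).congr_of_eventuallyEq ?_)
  filter_upwards [hN] with s hs
  exact coeff_eq_zero_of_natDegree_lt (hs.trans_lt hi)

lemma wInt (h : HasPolyDerivAt p q t) (ht : 0 < t) (j : ℕ) :
    HasDerivAt (fun s => wInt s j (p s)) (wInt t j q - wInt t (j + 2) (p t)) t := by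
  obtain ⟨N, hN⟩ := h.1
  have h1 : HasDerivAt
      (fun s => ∑ i ∈ Finset.range (N + 1), (p s).coeff i * _root_.wInt s j (X ^ i))
      (∑ i ∈ Finset.range (N + 1), (q.coeff i * _root_.wInt t j (X ^ i) +
        (p t).coeff i * -_root_.wInt t (j + 2) (X ^ i))) t :=
    HasDerivAt.fun_sum fun i _ => (h.2 i).mul (hasDerivAt_wInt_X_pow ht i j)
  refine (h1.congr_of_eventuallyEq ?_).congr_deriv ?_
  · filter_upwards [hN, Ioi_mem_nhds ht] with s hs hs0
    exact wInt_eq_sum hs0 j hs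
  · rw [wInt_eq_sum ht j (h.natDegree_le hN), wInt_eq_sum ht (j + 2) hN.self_of_nhds,
      ← Finset.sum_sub_distrib]
    exact Finset.sum_congr rfl fun i _ => by ring

end HasPolyDerivAt

/-- `P` is the sequence of monic orthogonal polynomials for the weight `w t`. -/
structure IsMonicOrthogonal (t : ℝ) (P : ℕ → ℝ[X]) : Prop where
  monic : ∀ n, (P n).Monic
  natDegree : ∀ n, (P n).natDegree = n
  orth : ∀ m n, m ≠ n → wInt t 0 (P m * P n) = 0
  pos : ∀ n, 0 < wInt t 0 (P n * P n)

namespace IsMonicOrthogonal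

variable {t : ℝ} {P : ℕ → ℝ[X]}

lemma coeff_self (hP : IsMonicOrthogonal t P) (n : ℕ) : (P n).coeff n = 1 := by
  have h := hP.monic n
  rwa [Monic, leadingCoeff, hP.natDegree] at h

lemma coeff_of_lt (hP : IsMonicOrthogonal t P) {n m : ℕ} (h : n < m) : (P n).coeff m = 0 :=
  coeff_eq_zero_of_natDegree_lt (by rwa [hP.natDegree])

lemma wInt_mul_of_degree_lt (hP : IsMonicOrthogonal t P) (ht : 0 < t) {d n : ℕ} (hd : d ≤ n)
    {q : ℝ[X]} (hq : ∀ m, d ≤ m → q.coeff m = 0) : wInt t 0 (q * P n) = 0 := by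
  induction d generalizing q with
  | zero =>
    have : q = 0 := by ext m; simp [hq m]
    rw [this, zero_mul, wInt_zero]
  | succ d ih =>
    have h1 : wInt t 0 ((q - C (q.coeff d) * P d) * P n) = 0 := by
      refine ih (by omega) fun m hm => ?_
      rcases hm.eq_or_lt with rfl | hm
      · simp [hP.coeff_self]
      · simp [hP.coeff_of_lt hm, hq m hm]
    have h2 : q * P n = (q - C (q.coeff d) * P d) * P n + C (q.coeff d) * (P d * P n) := by ring
    rw [h2, wInt_add _ ht, h1, wInt_C_mul, hP.orth d n (by omega), mul_zero, add_zero]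

/-- Pairing with `P n` reads off the `n`-th coefficient of polynomials of degree at most `n`. -/
lemma wInt_mul (hP : IsMonicOrthogonal t P) (ht : 0 < t) (n : ℕ) {q : ℝ[X]}
    (hq : ∀ m, n < m → q.coeff m = 0) :
    wInt t 0 (q * P n) = q.coeff n * wInt t 0 (P n * P n) := by
  have h1 : wInt t 0 ((q - C (q.coeff n) * P n) * P n) = 0 := by
    refine hP.wInt_mul_of_degree_lt ht le_rfl fun m hm => ?_
    rcases hm.eq_or_lt with rfl | hm
    · simp [hP.coeff_self]
    · simp [hP.coeff_of_lt hm, hq m hm]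
  have h2 : q * P n = (q - C (q.coeff n) * P n) * P n + C (q.coeff n) * (P n * P n) := by ring
  rw [h2, wInt_add _ ht, h1, wInt_C_mul, zero_add]

lemma eq_zero_of_orthogonal (hP : IsMonicOrthogonal t P) (ht : 0 < t) {n : ℕ} {q : ℝ[X]}
    (hq : ∀ m, n ≤ m → q.coeff m = 0) (h : ∀ k, k < n → wInt t 0 (q * P k) = 0) : q = 0 := by
  by_contra hne
  have hlt : q.natDegree < n := by
    by_contra! hle
    exact hne (leadingCoeff_eq_zero.mp (hq _ hle))
  have h1 := hP.wInt_mul ht q.natDegree (q := q) fun m hm => coeff_eq_zero_of_natDegree_lt hm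
  rw [h _ hlt] at h1
  rcases mul_eq_zero.mp h1.symm with h2 | h2
  · exact hne (leadingCoeff_eq_zero.mp h2)
  · exact (hP.pos _).ne' h2

lemma coeff_comp_neg_X (p : ℝ[X]) (i : ℕ) : (p.comp (-X)).coeff i = (-1) ^ i * p.coeff i := by
  rw [← neg_one_mul, ← C_1, ← C_neg, comp_C_mul_X_coeff, mul_comm]

lemma comp_neg_X (hP : IsMonicOrthogonal t P) (ht : 0 < t) (n : ℕ) :
    (P n).comp (-X) = C ((-1) ^ n) * P n := by
  refine sub_eq_zero.mp (hP.eq_zero_of_orthogonal ht (n := n) (fun m hm => ?_) fun k hk => ?_)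
  · rw [coeff_sub, coeff_comp_neg_X, coeff_C_mul]
    rcases hm.eq_or_lt with rfl | hm
    · ring
    · rw [hP.coeff_of_lt hm]; ring
  · have h1 : wInt t 0 ((P n).comp (-X) * P k) = 0 := by
      rw [← wInt_zero_comp_neg_X, mul_comp, comp_neg_X_comp_neg_X, mul_comm]
      refine hP.wInt_mul_of_degree_lt ht le_rfl fun m hm => ?_
      rw [coeff_comp_neg_X, hP.coeff_of_lt (by omega), mul_zero]
    rw [sub_mul, wInt_sub _ ht, h1, mul_assoc, wInt_C_mul, hP.orth n k hk.ne', mul_zero, sub_zero]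

lemma coeff_eq_zero_of_odd (hP : IsMonicOrthogonal t P) (ht : 0 < t) {n i : ℕ}
    (h : Odd (n + i)) : (P n).coeff i = 0 := by
  have h1 := congrArg (fun p => coeff p i) (hP.comp_neg_X ht n)
  simp only [coeff_comp_neg_X, coeff_C_mul] at h1
  rcases Nat.even_or_odd n with hn | hn
  · have hi : Odd i := by grind
    rw [hn.neg_one_pow, hi.neg_one_pow] at h1
    linarith
  · have hi : Even i := by grind
    rw [hn.neg_one_pow, hi.neg_one_pow] at h1
    linarith

lemma eq_C_add (p : ℝ[X]) : p = C (p.coeff 0) + X * divX p := by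
  conv_lhs => rw [← X_mul_divX_add p, add_comm]

lemma eq_of_coeff_one_eq_zero {p : ℝ[X]} (h : p.coeff 1 = 0) :
    p = C (p.coeff 0) + X * (X * divX (divX p)) := by
  have h1 := eq_C_add (divX p)
  rw [coeff_divX, zero_add, h, C_0, zero_add] at h1
  rw [← h1, ← eq_C_add]

lemma eq_of_coeff_zero_eq_zero {p : ℝ[X]} (h : p.coeff 0 = 0) :
    p = X * (C (p.coeff 1) + X * divX (divX p)) := by
  have h1 := eq_C_add (divX p)
  rw [coeff_divX, zero_add] at h1
  rw [← h1]
  conv_lhs => rw [eq_C_add p, h, C_0, zero_add]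

lemma wInt_zero_sq_eq_of_even (hP : IsMonicOrthogonal t P) (ht : 0 < t) {n : ℕ} (hn : Even n) :
    2 * t * wInt t 4 (P n * P n) = 2 * wInt t 0 (P n * P n) + wInt t 2 (P n * P n) := by
  have h := wInt_parts 1 ht (P n * P n)
  have h1 : (P n).coeff 1 = 0 := hP.coeff_eq_zero_of_odd ht (by grind)
  have h2 : derivative (P n * P n) = X * (C 2 * (divX (derivative (P n)) * P n)) := by
    have h3 := eq_C_add (derivative (P n))
    rw [coeff_derivative, zero_add, h1, zero_mul, C_0, zero_add] at h3
    rw [derivative_mul, C_ofNat]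
    linear_combination 2 * P n * h3
  have h4 : wInt t 0 (divX (derivative (P n)) * P n) = 0 :=
    hP.wInt_mul_of_degree_lt ht le_rfl fun m hm => by
      rw [coeff_divX, coeff_derivative, hP.coeff_of_lt (by omega), zero_mul]
  rw [h2, wInt_X_mul, wInt_X_mul, wInt_C_mul, h4] at h
  push_cast at h
  linarith

lemma wInt_zero_sq_eq_of_odd (hP : IsMonicOrthogonal t P) (ht : 0 < t) {n : ℕ} (hn : Odd n) :
    2 * t * wInt t 4 (P n * P n) = 2 * wInt t 0 (P n * P n) - wInt t 2 (P n * P n) := by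
  have h := wInt_parts 1 ht (P n * P n)
  have h1 : (P n).coeff 0 = 0 := hP.coeff_eq_zero_of_odd ht (by grind)
  have h2 : derivative (P n * P n) =
      C (2 * (P n).coeff 1) * P n + X * (C 2 * (divX (derivative (P n)) * P n)) := by
    have h3 := eq_C_add (derivative (P n))
    rw [coeff_derivative, zero_add, Nat.cast_zero, zero_add, mul_one] at h3
    rw [derivative_mul, C_mul, C_ofNat]
    linear_combination 2 * P n * h3
  have h4 : wInt t 0 (divX (derivative (P n)) * P n) = 0 :=
    hP.wInt_mul_of_degree_lt ht le_rfl fun m hm => by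
      rw [coeff_divX, coeff_derivative, hP.coeff_of_lt (by omega), zero_mul]
  have h5 : wInt t 2 (P n * P n) = (P n).coeff 1 * wInt t 1 (P n) := by
    have h6 : P n * P n = X * (C ((P n).coeff 1) * P n + X * (divX (divX (P n)) * P n)) := by
      linear_combination P n * eq_of_coeff_zero_eq_zero h1
    rw [h6, wInt_X_mul, wInt_add _ ht, wInt_C_mul, wInt_X_mul,
      hP.wInt_mul_of_degree_lt ht le_rfl fun m hm => by
        rw [coeff_divX, coeff_divX, hP.coeff_of_lt (by omega)], add_zero]
  rw [h2, wInt_add _ ht, wInt_X_mul, wInt_X_mul, wInt_C_mul, wInt_C_mul, h4] at h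
  push_cast at h
  linarith

variable {n : ℕ} {Q : ℝ[X]}

lemma wInt_two_mul_deriv_of_even (hP : IsMonicOrthogonal t P) (ht : 0 < t) (hn : Even (n + 1))
    (hQ : ∀ m, n + 1 ≤ m → Q.coeff m = 0) (hQ1 : Q.coeff 1 = 0)
    (hQP : ∀ k : ℝ[X], (∀ m, n + 1 ≤ m → k.coeff m = 0) →
      wInt t 0 (Q * k) = wInt t 2 (P (n + 1) * k)) :
    wInt t 0 (P n * P n) * wInt t 2 (P (n + 1) * Q) =
      -(wInt t 3 (P (n + 1) * P n) * wInt t 2 (P (n + 1) * P (n + 1))) := by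
  have hp1 : (P (n + 1)).coeff 1 = 0 := hP.coeff_eq_zero_of_odd ht (by grind)
  have hn0 : (P n).coeff 0 = 0 := hP.coeff_eq_zero_of_odd ht (by grind)
  have eP := eq_of_coeff_one_eq_zero hp1
  have eQ := eq_of_coeff_one_eq_zero hQ1
  have ek : P n = X * divX (P n) := by
    conv_lhs => rw [eq_C_add (P n), hn0, C_0, zero_add]
  set k := divX (P n) with hk
  set u := divX (divX (P (n + 1))) with hu
  set v := divX (divX Q) with hv
  set a := (P (n + 1)).coeff 0
  set b := Q.coeff 0
  have hud : ∀ m, n ≤ m → u.coeff m = 0 := fun m hm => by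
    rw [hu, coeff_divX, coeff_divX, hP.coeff_of_lt (by omega)]
  have hvd : ∀ m, n ≤ m → v.coeff m = 0 := fun m hm => by
    rw [hv, coeff_divX, coeff_divX, hQ _ (by omega)]
  have hkd : ∀ m, n + 1 ≤ m → k.coeff m = 0 := fun m hm => by
    rw [hk, coeff_divX, hP.coeff_of_lt (by omega)]
  have hJ : wInt t 2 (P (n + 1) * P (n + 1)) = a * wInt t 2 (P (n + 1)) := by
    rw [show P (n + 1) * P (n + 1) = C a * P (n + 1) + X * (X * (u * P (n + 1))) by
        linear_combination P (n + 1) * eP,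
      wInt_add _ ht, wInt_C_mul, wInt_X_mul, wInt_X_mul,
      hP.wInt_mul_of_degree_lt ht n.le_succ hud, add_zero]
  have hD : wInt t 2 (P (n + 1) * Q) = b * wInt t 2 (P (n + 1)) := by
    rw [show P (n + 1) * Q = C b * P (n + 1) + X * (X * (v * P (n + 1))) by
        linear_combination P (n + 1) * eQ,
      wInt_add _ ht, wInt_C_mul, wInt_X_mul, wInt_X_mul,
      hP.wInt_mul_of_degree_lt ht n.le_succ hvd, add_zero]
  have hk1 : a * wInt t 0 k + wInt t 0 (P n * P n) = 0 := by
    have h1 : wInt t 0 (k * P (n + 1)) = 0 := hP.wInt_mul_of_degree_lt ht le_rfl hkd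
    have hXu : ∀ m, n < m → (X * u).coeff m = 0 := fun m hm => by
      obtain ⟨m, rfl⟩ : ∃ l, m = l + 1 := ⟨m - 1, by omega⟩
      rw [coeff_X_mul, hud m (by omega)]
    have hXun : (X * u).coeff n = 1 := by
      obtain ⟨l, rfl⟩ : ∃ l, n = l + 1 := ⟨n - 1, by grind⟩
      rw [coeff_X_mul, hu, coeff_divX, coeff_divX, hP.coeff_self]
    rw [show k * P (n + 1) = C a * k + X * u * P n by linear_combination k * eP - X * u * ek,
      wInt_add _ ht, wInt_C_mul, hP.wInt_mul ht n hXu, hXun, one_mul] at h1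
    exact h1
  have hk2 : wInt t 3 (P (n + 1) * P n) = b * wInt t 0 k := by
    have h1 := hQP k hkd
    rw [show Q * k = C b * k + X * v * P n by linear_combination k * eQ - X * v * ek,
      wInt_add _ ht, wInt_C_mul, hP.wInt_mul_of_degree_lt ht le_rfl, add_zero] at h1
    · rw [h1, show P (n + 1) * P n = X * (P (n + 1) * k) by linear_combination P (n + 1) * ek,
        wInt_X_mul]
    · intro m hm
      rcases m with _ | m
      · simp
      · rw [coeff_X_mul, hv, coeff_divX, coeff_divX, hQ _ (by omega)]
  rw [hJ, hD, hk2]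
  linear_combination b * wInt t 2 (P (n + 1)) * hk1

lemma wInt_two_mul_deriv_of_odd (hP : IsMonicOrthogonal t P) (ht : 0 < t) (hn : Odd (n + 1))
    (hQ : ∀ m, n + 1 ≤ m → Q.coeff m = 0) (hQ0 : Q.coeff 0 = 0)
    (hQP : ∀ k : ℝ[X], (∀ m, n + 1 ≤ m → k.coeff m = 0) →
      wInt t 0 (Q * k) = wInt t 2 (P (n + 1) * k)) :
    wInt t 0 (P n * P n) * wInt t 2 (P (n + 1) * Q) =
      wInt t 0 (P n * P n) * wInt t 4 (P (n + 1) * P (n + 1)) -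
        wInt t 3 (P (n + 1) * P n) * wInt t 2 (P (n + 1) * P (n + 1)) := by
  have hp0 : (P (n + 1)).coeff 0 = 0 := hP.coeff_eq_zero_of_odd ht (by grind)
  have hn1 : (P n).coeff 1 = 0 := hP.coeff_eq_zero_of_odd ht (by grind)
  have eP := eq_of_coeff_zero_eq_zero hp0
  have eQ := eq_of_coeff_zero_eq_zero hQ0
  have en := eq_of_coeff_one_eq_zero hn1
  set u := divX (divX (P (n + 1))) with hu
  set v := divX (divX Q) with hv
  set e := divX (divX (P n)) with he
  set b := (P (n + 1)).coeff 1
  set d := Q.coeff 1 with hd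
  set c := (P n).coeff 0
  have hud : ∀ m, n ≤ m → u.coeff m = 0 := fun m hm => by
    rw [hu, coeff_divX, coeff_divX, hP.coeff_of_lt (by omega)]
  have hvd : ∀ m, n ≤ m + 1 → v.coeff m = 0 := fun m hm => by
    rw [hv, coeff_divX, coeff_divX, hQ _ (by omega)]
  have hed : ∀ m, n ≤ m → e.coeff m = 0 := fun m hm => by
    rw [he, coeff_divX, coeff_divX, hP.coeff_of_lt (by omega)]
  have hB : ∀ q : ℝ[X], (∀ m, n ≤ m → q.coeff m = 0) →
      wInt t 0 (q * P (n + 1)) = 0 := fun q => hP.wInt_mul_of_degree_lt ht n.le_succ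
  have hJ : wInt t 2 (P (n + 1) * P (n + 1)) = b * wInt t 1 (P (n + 1)) := by
    rw [show P (n + 1) * P (n + 1) = X * (C b * P (n + 1) + X * (u * P (n + 1))) by
        linear_combination P (n + 1) * eP,
      wInt_X_mul, wInt_add _ ht, wInt_C_mul, wInt_X_mul, hB u hud, add_zero]
  have hD : wInt t 2 (P (n + 1) * Q) = d * wInt t 1 (P (n + 1)) := by
    rw [show P (n + 1) * Q = X * (C d * P (n + 1) + X * (v * P (n + 1))) by
        linear_combination P (n + 1) * eQ,
      wInt_X_mul, wInt_add _ ht, wInt_C_mul, wInt_X_mul, hB v fun m hm => hvd m (by omega),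
      add_zero]
  have hc : c * wInt t 1 (P (n + 1)) = wInt t 0 (P n * P n) := by
    have h1 : wInt t 0 ((C b + X * u) * P n) = wInt t 0 (P n * P n) := by
      have hg : C b + X * u = divX (P (n + 1)) := by
        have h2 := eq_C_add (divX (P (n + 1)))
        rw [coeff_divX, zero_add] at h2
        exact h2.symm
      rw [hg, hP.wInt_mul ht n, coeff_divX, hP.coeff_self, one_mul]
      intro m hm
      rw [coeff_divX, hP.coeff_of_lt (by omega)]
    rw [← h1, show (C b + X * u) * P n = C c * (C b + X * u) + X * e * P (n + 1) by
        linear_combination (C b + X * u) * en - X * e * eP,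
      wInt_add _ ht, wInt_C_mul, hP.wInt_mul_of_degree_lt ht le_rfl, add_zero]
    · conv_lhs => rw [eP, wInt_X_mul]
    · intro m hm
      rcases m with _ | m
      · simp
      · rw [coeff_X_mul, hed m (by omega)]
  have hk : d * wInt t 0 (P n * P n) =
      c * wInt t 4 (P (n + 1) * P (n + 1)) - b * wInt t 3 (P (n + 1) * P n) := by
    have h1 := hQP (C c * u - C b * (X * e)) fun m hm => by
      obtain ⟨m, rfl⟩ : ∃ l, m = l + 1 := ⟨m - 1, by omega⟩
      rw [coeff_sub, coeff_C_mul, coeff_C_mul, hud _ (by omega), coeff_X_mul, hed m (by omega)]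
      ring
    have h2 : wInt t 2 (P (n + 1) * (C c * u - C b * (X * e))) =
        c * wInt t 4 (P (n + 1) * P (n + 1)) - b * wInt t 3 (P (n + 1) * P n) := by
      rw [← wInt_C_mul, ← wInt_C_mul, ← wInt_X_mul 2, ← wInt_X_mul 3 (C b * _), ← wInt_sub _ ht,
        ← wInt_X_mul]
      congr 1
      linear_combination C b * X * P (n + 1) * en - C c * P (n + 1) * eP
    have h3 : Q * (C c * u - C b * (X * e)) =
        C (d * c) * (C b + X * u) - C (d * b) * P n + (C c * (v * P (n + 1))
          - C b * (X * v * P n)) := by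
      simp only [C_mul]
      linear_combination (C c * u - C b * (X * e)) * eQ - C c * v * eP + (C d * C b + C b * X * v) * en
    have h4 : wInt t 0 (X * v * P n) = 0 := hP.wInt_mul_of_degree_lt ht le_rfl fun m hm => by
      rcases m with _ | m
      · simp
      · rw [coeff_X_mul, hvd m (by omega)]
    have h5 : d * wInt t 0 (P n) = 0 := by
      rcases Nat.eq_zero_or_pos n with rfl | hpos
      · rw [hd, hQ 1 (by omega), zero_mul]
      · have h6 := hP.wInt_mul_of_degree_lt ht (d := 1) (n := n) hpos (q := 1) fun m hm => by
          rw [coeff_one, if_neg (by omega)]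
        rw [one_mul] at h6
        rw [h6, mul_zero]
    have h7 : wInt t 1 (P (n + 1)) = wInt t 0 (C b + X * u) := by
      conv_lhs => rw [eP, wInt_X_mul]
    rw [h2, h3, wInt_add _ ht, wInt_sub _ ht, wInt_sub _ ht, wInt_C_mul, wInt_C_mul, wInt_C_mul,
      wInt_C_mul, h4, hB v fun m hm => hvd m (by omega), ← h7] at h1
    linear_combination h1 - d * hc + b * h5
  rw [hJ, hD]
  linear_combination wInt t 1 (P (n + 1)) * hk +
    wInt t 4 (P (n + 1) * P (n + 1)) * hc

end IsMonicOrthogonal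

theorem statement15
    (P : ℕ → ℝ → Polynomial ℝ)
    (hmonic : ∀ n : ℕ, ∀ t : ℝ, 0 < t → (P n t).Monic)
    (hdeg : ∀ n : ℕ, ∀ t : ℝ, 0 < t → (P n t).natDegree = n)
    (horth : ∀ m n : ℕ, m ≠ n → ∀ t : ℝ, 0 < t →
      ∫ x : ℝ, (P m t).eval x * (P n t).eval x * w t x = 0)
    (hcoeff : ∀ n k : ℕ, ∀ t : ℝ, 0 < t →
      DifferentiableAt ℝ (fun s => (P n s).coeff k) t)
    (h : ℕ → ℝ → ℝ)
    (hh : ∀ n : ℕ, ∀ t : ℝ, 0 < t → h n t = ∫ x : ℝ, ((P n t).eval x) ^ 2 * w t x)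
    (hhpos : ∀ n : ℕ, ∀ t : ℝ, 0 < t → 0 < h n t)
    (R : ℕ → ℝ → ℝ)
    (hR : ∀ n : ℕ, ∀ t : ℝ, 0 < t →
      R n t = 2 * t / h n t * ∫ y : ℝ, ((P n t).eval y) ^ 2 / y ^ 2 * w t y)
    (r : ℕ → ℝ → ℝ)
    (hr : ∀ n : ℕ, 1 ≤ n → ∀ t : ℝ, 0 < t → r n t = 2 * t / h (n - 1) t *
      ∫ y : ℝ, (P n t).eval y * (P (n - 1) t).eval y / y ^ 3 * w t y)
    (n : ℕ) (hn : 1 ≤ n) (t₀ : ℝ) (ht₀ : 0 < t₀) :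
    ∃ d : ℝ, HasDerivAt (R n) d t₀ ∧
      2 * t₀ * d = (R n t₀) ^ 2 + (1 - 2 * r n t₀) * R n t₀ - 4 * (-1 : ℝ) ^ n * t₀ := by
  have hh' : ∀ n t, 0 < t → h n t = wInt t 0 (P n t * P n t) := fun n t ht => by
    simp [hh n t ht, wInt, sq]
  have hR' : ∀ n t, 0 < t → R n t = 2 * t / h n t * wInt t 2 (P n t * P n t) := fun n t ht => by
    simp [hR n t ht, wInt, sq]
  have hr' : ∀ n, 1 ≤ n → ∀ t, 0 < t →
      r n t = 2 * t / h (n - 1) t * wInt t 3 (P n t * P (n - 1) t) := fun n hn t ht => by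
    simp [hr n hn t ht, wInt]
  have hP : ∀ t, 0 < t → IsMonicOrthogonal t (fun n => P n t) := fun t ht =>
    ⟨fun n => hmonic n t ht, fun n => hdeg n t ht,
      fun m n hmn => by simpa [wInt] using horth m n hmn t ht,
      fun n => by rw [← hh' n t ht]; exact hhpos n t ht⟩
  have hpos : ∀ᶠ s in nhds t₀, 0 < s := Ioi_mem_nhds ht₀
  obtain ⟨n, rfl⟩ : ∃ m, n = m + 1 := ⟨n - 1, by omega⟩
  have hconst : ∀ m c, (∀ s, 0 < s → (P (n + 1) s).coeff m = c) →
      deriv (fun s => (P (n + 1) s).coeff m) t₀ = 0 := fun m c hc => by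
    have he : (fun s => (P (n + 1) s).coeff m) =ᶠ[nhds t₀] fun _ => c := by
      filter_upwards [hpos] with s hs using hc s hs
    rw [he.deriv_eq, deriv_const]
  have hlead : ∀ m, n + 1 ≤ m → deriv (fun s => (P (n + 1) s).coeff m) t₀ = 0 := fun m hm => by
    rcases hm.eq_or_lt with rfl | hm
    · exact hconst _ 1 fun s hs => (hP s hs).coeff_self _
    · exact hconst _ 0 fun s hs => (hP s hs).coeff_of_lt hm
  obtain ⟨Q, hQ⟩ : ∃ Q : ℝ[X], ∀ m, Q.coeff m = deriv (fun s => (P (n + 1) s).coeff m) t₀ := by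
    refine ⟨∑ i ∈ Finset.range (n + 1),
      monomial i (deriv (fun s => (P (n + 1) s).coeff i) t₀), fun m => ?_⟩
    simp only [finsetSum_coeff, coeff_monomial, Finset.sum_ite_eq', Finset.mem_range]
    split_ifs with hm
    · rfl
    · exact (hlead m (by omega)).symm
  have hPQ : HasPolyDerivAt (P (n + 1)) Q t₀ := by
    refine ⟨⟨n + 1, ?_⟩, fun i => by
      rw [hQ i]; exact (hcoeff (n + 1) i t₀ ht₀).hasDerivAt⟩
    filter_upwards [hpos] with s hs using (hdeg (n + 1) s hs).le
  have hQd : ∀ m, n + 1 ≤ m → Q.coeff m = 0 := fun m hm => by rw [hQ, hlead m hm]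
  have hQodd : ∀ m, Odd (n + 1 + m) → Q.coeff m = 0 := fun m hm => by
    rw [hQ, hconst m 0 fun s hs => (hP s hs).coeff_eq_zero_of_odd hs hm]
  have hQP : ∀ k : ℝ[X], (∀ m, n + 1 ≤ m → k.coeff m = 0) →
      wInt t₀ 0 (Q * k) = wInt t₀ 2 (P (n + 1) t₀ * k) := fun k hk => by
    have h1 := (hPQ.mul (.const k t₀)).wInt ht₀ 0
    have h2 : HasDerivAt (fun s => wInt s 0 (P (n + 1) s * k)) 0 t₀ := by
      refine (hasDerivAt_const t₀ (0 : ℝ)).congr_of_eventuallyEq ?_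
      filter_upwards [hpos] with s hs
      rw [mul_comm]
      exact (hP s hs).wInt_mul_of_degree_lt hs le_rfl hk
    have h3 := h1.unique h2
    rw [mul_zero, add_zero] at h3
    linarith
  have hsq := fun j => (hPQ.mul hPQ).wInt ht₀ j
  have hsum : ∀ j, wInt t₀ j (Q * P (n + 1) t₀ + P (n + 1) t₀ * Q) =
      2 * wInt t₀ j (P (n + 1) t₀ * Q) := fun j => by
    rw [wInt_add _ ht₀, mul_comm Q]; ring
  have hPQ0 : wInt t₀ 0 (P (n + 1) t₀ * Q) = 0 := by
    rw [mul_comm]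
    exact (hP t₀ ht₀).wInt_mul_of_degree_lt ht₀ le_rfl hQd
  have h0 := hsq 0
  have h2 := hsq 2
  rw [hsum] at h0 h2
  rw [hPQ0] at h0
  have hne : wInt t₀ 0 (P (n + 1) t₀ * P (n + 1) t₀) ≠ 0 := ((hP t₀ ht₀).pos (n + 1)).ne'
  have hne' : wInt t₀ 0 (P n t₀ * P n t₀) ≠ 0 := ((hP t₀ ht₀).pos n).ne'
  have hRd := (((hasDerivAt_id t₀).const_mul 2).div h0 hne).mul h2
  refine ⟨_, hRd.congr_of_eventuallyEq ?_, ?_⟩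
  · filter_upwards [hpos] with s hs
    rw [hR' _ s hs, hh' _ s hs]
    rfl
  rw [hR' _ _ ht₀, hr' _ hn _ ht₀, hh' _ _ ht₀, hh' _ _ ht₀, Nat.add_sub_cancel]
  simp only [Pi.div_apply, id_eq]
  rcases Nat.even_or_odd (n + 1) with he | ho
  · have e1 := (hP t₀ ht₀).wInt_zero_sq_eq_of_even ht₀ he
    have e2 := (hP t₀ ht₀).wInt_two_mul_deriv_of_even ht₀ he hQd (hQodd 1 (by grind)) hQP
    rw [he.neg_one_pow]
    generalize wInt t₀ 0 (P (n + 1) t₀ * P (n + 1) t₀) = H at *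
    generalize wInt t₀ 2 (P (n + 1) t₀ * P (n + 1) t₀) = J at *
    generalize wInt t₀ 4 (P (n + 1) t₀ * P (n + 1) t₀) = M at *
    generalize wInt t₀ 0 (P n t₀ * P n t₀) = G at *
    generalize wInt t₀ 3 (P (n + 1) t₀ * P n t₀) = S at *
    generalize wInt t₀ 2 (P (n + 1) t₀ * Q) = D at *
    field_simp
    linear_combination 8 * t₀ * e2 * H - 2 * e1 * H * G
  · have e1 := (hP t₀ ht₀).wInt_zero_sq_eq_of_odd ht₀ ho
    have e2 := (hP t₀ ht₀).wInt_two_mul_deriv_of_odd ht₀ ho hQd (hQodd 0 (by grind)) hQP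
    rw [ho.neg_one_pow]
    generalize wInt t₀ 0 (P (n + 1) t₀ * P (n + 1) t₀) = H at *
    generalize wInt t₀ 2 (P (n + 1) t₀ * P (n + 1) t₀) = J at *
    generalize wInt t₀ 4 (P (n + 1) t₀ * P (n + 1) t₀) = M at *
    generalize wInt t₀ 0 (P n t₀ * P n t₀) = G at *
    generalize wInt t₀ 3 (P (n + 1) t₀ * P n t₀) = S at *
    generalize wInt t₀ 2 (P (n + 1) t₀ * Q) = D at *
    field_simp
    linear_combination 8 * t₀ * e2 * H + 2 * e1 * H * G
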